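/- Let 1 → U → G →(π) T → 1 be a short exact sequence of groups and Q a G-group. Suppose that for every γ ∈ Z^1(G,Q), every 1-cocycle T → (Q_γ)^U is a coboundary (here (Q_γ)^U, the set of U-fixed points of the twisted G-group Q_γ, is a T-group because the twisted G-action on it factors through T). Then the restriction map H^1(G,Q) → H^1(U,Q) is injective. -/

import Mathlib

/-- A right action of a group `G` on a group `Q` by group automorphisms,
written `q ↦ q^g` in the paper; here `act q g`. -/
structure GAction (G : Type*) (Q : Type*) [Group G] [Group Q] where
  act : Q → G → Q
  act_one : ∀ q, act q 1 = q
  act_mul : ∀ q g h, act (act q g) h = act q (g * h)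
  act_map_mul : ∀ g q q', act (q * q') g = act q g * act q' g

namespace GAction

variable {G Q : Type*} [Group G] [Group Q]

/-- `γ : G → Q` is a 1-cocycle: `γ(gh) = γ(g)^h · γ(h)`. -/
def IsCocycle (A : GAction G Q) (γ : G → Q) : Prop :=
  ∀ g h : G, γ (g * h) = A.act (γ g) h * γ h

/-- Two 1-cochains are cohomologous: `δ(g) = (q^g)⁻¹ · γ(g) · q` for some `q`. -/
def Cohomologous (A : GAction G Q) (γ δ : G → Q) : Prop :=
  ∃ q : Q, ∀ g : G, δ g = (A.act q g)⁻¹ * γ g * q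

/-- `τ : G × G → Q` is a 2-cocycle: `τ(g,h)^k · τ(gh,k) = τ(h,k) · τ(g,hk)`. -/
def IsTwoCocycle (A : GAction G Q) (τ : G → G → Q) : Prop :=
  ∀ g h k : G, A.act (τ g h) k * τ (g * h) k = τ h k * τ g (h * k)

/-- Two 2-cochains are cohomologous:
`τ'(g,h) = τ(g,h) · φ(g)^h · φ(h) · φ(gh)⁻¹` for some `φ : G → Q`. -/
def TwoCohomologous (A : GAction G Q) (τ τ' : G → G → Q) : Prop :=
  ∃ φ : G → Q, ∀ g h : G, τ' g h = τ g h * A.act (φ g) h * φ h * (φ (g * h))⁻¹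

/-- The restriction of a `G`-action to a subgroup `B ≤ G`. -/
def res (A : GAction G Q) (B : Subgroup G) : GAction B Q where
  act q b := A.act q (b : G)
  act_one q := by simpa using A.act_one q
  act_mul q b c := by simpa using A.act_mul q (b : G) (c : G)
  act_map_mul b q q' := A.act_map_mul (b : G) q q'

end GAction

/-- `1 → R →(ι) Q →(π) S → 1` is a central extension of `G`-groups. -/
structure IsCentralExt {G R Q S : Type*} [Group G] [Group R] [Group Q] [Group S]
    (AR : GAction G R) (AQ : GAction G Q) (AS : GAction G S)
    (ι : R →* Q) (π : Q →* S) : Prop where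
  ι_inj : Function.Injective ι
  π_surj : Function.Surjective π
  exact : ∀ q : Q, π q = 1 ↔ ∃ r : R, ι r = q
  ι_equiv : ∀ (r : R) (g : G), ι (AR.act r g) = AQ.act (ι r) g
  π_equiv : ∀ (q : Q) (g : G), π (AQ.act q g) = AS.act (π q) g
  central : ∀ (r : R) (q : Q), ι r * q = q * ι r

namespace GAction

variable {G Q : Type*} [Group G] [Group Q]

theorem act_inv (A : GAction G Q) (q : Q) (g : G) : A.act q⁻¹ g = (A.act q g)⁻¹ :=
  map_inv (MonoidHom.mk' (fun q => A.act q g) (A.act_map_mul g)) q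

theorem one_act (A : GAction G Q) (g : G) : A.act 1 g = 1 :=
  map_one (MonoidHom.mk' (fun q => A.act q g) (A.act_map_mul g))

theorem IsCocycle.of_cohomologous {A : GAction G Q} {γ δ : G → Q} (hγ : A.IsCocycle γ)
    (h : A.Cohomologous γ δ) : A.IsCocycle δ := by
  obtain ⟨q, hq⟩ := h
  intro g h
  simp only [hq, hγ g h, A.act_map_mul, A.act_inv, A.act_mul]
  group

theorem Cohomologous.trans {A : GAction G Q} {γ δ ε : G → Q} (h : A.Cohomologous γ δ)
    (h' : A.Cohomologous δ ε) : A.Cohomologous γ ε := by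
  obtain ⟨q, hq⟩ := h
  obtain ⟨r, hr⟩ := h'
  refine ⟨q * r, fun g => ?_⟩
  rw [hr, hq, A.act_map_mul]
  group

/-- The quotient of two cocycles is a cocycle for the action twisted by the first one. -/
theorem IsCocycle.inv_mul {A : GAction G Q} {γ δ : G → Q} (hγ : A.IsCocycle γ)
    (hδ : A.IsCocycle δ) (g h : G) :
    (γ (g * h))⁻¹ * δ (g * h) =
      (γ h)⁻¹ * A.act ((γ g)⁻¹ * δ g) h * γ h * ((γ h)⁻¹ * δ h) := by
  rw [hγ, hδ, A.act_map_mul, A.act_inv]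
  group

end GAction

/-- Let `1 → U → G → T → 1` be a short exact sequence of groups
(`U ⊴ G`, `T = G/U`) and `Q` a `G`-group.  Suppose that for every `γ ∈ Z¹(G,Q)`,
every `1`-cocycle of `T` with values in `(Q_γ)^U` is a coboundary.  (A cocycle
`T → (Q_γ)^U` is encoded as a function `c : G → Q` which is constant on `U`-cosets,
takes values in the `U`-fixed points of the twisted action
`q * g = γ(g)⁻¹ · q^g · γ(g)`, and satisfies the twisted cocycle condition.)
Then the restriction map `H¹(G,Q) → H¹(U,Q)` is injective. -/
theorem restriction_injective_of_twisted_inflation_trivial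
    {G Q : Type*} [Group G] [Group Q]
    (A : GAction G Q) (U : Subgroup G) (hU : U.Normal)
    (hyp : ∀ γ : G → Q, A.IsCocycle γ →
      ∀ c : G → Q,
        (∀ g : G, ∀ u ∈ U, c (g * u) = c g) →
        (∀ g : G, ∀ u ∈ U, (γ u)⁻¹ * A.act (c g) u * γ u = c g) →
        (∀ g h : G, c (g * h) = (γ h)⁻¹ * A.act (c g) h * γ h * c h) →
        ∃ q : Q, (∀ u ∈ U, (γ u)⁻¹ * A.act q u * γ u = q) ∧
          ∀ g : G, c g = ((γ g)⁻¹ * A.act q g * γ g)⁻¹ * q) :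
    ∀ γ δ : G → Q, A.IsCocycle γ → A.IsCocycle δ →
      (A.res U).Cohomologous (fun u => γ (u : G)) (fun u => δ (u : G)) →
      A.Cohomologous γ δ := by
  intro γ δ hγ hδ ⟨p, hp⟩
  let δ' : G → Q := fun g => A.act p g * δ g * p⁻¹
  have hδδ' : A.Cohomologous δ δ' := ⟨p⁻¹, fun g => by simp [δ', A.act_inv]⟩
  have hδ'δ : A.Cohomologous δ' δ := ⟨p, fun g => by simp [δ', mul_assoc]⟩
  have hmul := hγ.inv_mul (hδ.of_cohomologous hδδ')
  have hone : ∀ u ∈ U, (γ u)⁻¹ * δ' u = 1 := fun u hu => by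
    have hu' : δ u = (A.act p u)⁻¹ * γ u * p := hp ⟨u, hu⟩
    simp [δ', hu', mul_assoc]
  have hconst : ∀ g, ∀ u ∈ U, (γ (g * u))⁻¹ * δ' (g * u) = (γ g)⁻¹ * δ' g := fun g u hu => by
    have h := hmul (g * u * g⁻¹) g
    rw [hone _ (hU.conj_mem u hu g), A.one_act] at h
    simpa using h
  have hfixed : ∀ g, ∀ u ∈ U,
      (γ u)⁻¹ * A.act ((γ g)⁻¹ * δ' g) u * γ u = (γ g)⁻¹ * δ' g := fun g u hu => by
    have h := hmul g u
    rw [hconst g u hu, hone u hu, mul_one] at h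
    exact h.symm
  obtain ⟨q, -, hq⟩ := hyp γ hγ (fun g => (γ g)⁻¹ * δ' g) hconst hfixed hmul
  refine GAction.Cohomologous.trans ⟨q, fun g => ?_⟩ hδ'δ
  rw [inv_mul_eq_iff_eq_mul.mp (hq g)]
  group
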